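/- (Conditional form of the oscillation estimate in the proof of Theorem 1.2, pole at y0.) Let n ≥ 3, let Ω ⊂ ℝⁿ be a bounded open set, let A : Ω → ℝ^{n×n} be measurable, let x0 ∈ Ω, and suppose |A(x) − A(x0)| ≤ Λ0 for all x ∈ Ω. Let y0 ∈ Ω with y0 ≠ x0 and set r := |x0 − y0|/5. Let δ > 0 and let η : ℝⁿ → ℝ be Lipschitz with 0 ≤ η ≤ 1 and Lipschitz constant ≤ 4/δ. Let C0 ≥ 0 and let G̃ : Ω \ {y0} → ℝ be measurable with (i) |G̃(x)| ≤ C0 |x − y0|^{2−n} for all x ∈ Ω \ {y0}, and (ii) |G̃(x) − G̃(y)| ≤ C0 t r^{1−n} whenever t ∈ (0,r], x̄ ∈ Ω(x0, 2r), and x, y ∈ Ω(x̄, t). Define g̃ := −η·(A − A(x0))·G̃ on Ω \ {y0}. Then there exists C = C(n, Λ0, C0) such that for all t ∈ (0,r]: ω_{g̃}(t, Ω(x0,2r)) ≤ C r^{2−n} ( ω_A(t) + ((r + δ)/(δ r)) · ϱ_A(3r, x0) · t ). -/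

import Mathlib

open MeasureTheory Metric Set

/-- Mean oscillation `ω_f(r,x) = ⨍_{Ω(x,r)} |f - f̄_{Ω(x,r)}|` over `Ω(x,r) = Ω ∩ B(x,r)`. -/
noncomputable def meanOsc (n : ℕ) {V : Type*} [NormedAddCommGroup V] [NormedSpace ℝ V]
    (Ω : Set (EuclideanSpace ℝ (Fin n))) (f : EuclideanSpace ℝ (Fin n) → V) (r : ℝ)
    (x : EuclideanSpace ℝ (Fin n)) : ℝ :=
  ⨍ y in Ω ∩ ball x r, ‖f y - ⨍ z in Ω ∩ ball x r, f z‖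

/-- `ω_f(r, D) = sup_{x ∈ D} ω_f(r,x)`. -/
noncomputable def meanOscSup (n : ℕ) {V : Type*} [NormedAddCommGroup V] [NormedSpace ℝ V]
    (Ω : Set (EuclideanSpace ℝ (Fin n))) (f : EuclideanSpace ℝ (Fin n) → V) (r : ℝ)
    (D : Set (EuclideanSpace ℝ (Fin n))) : ℝ :=
  sSup ((fun x => meanOsc n Ω f r x) '' D)

/-- `ϱ_A(r, x0) = sup {|A(x) - A(x0)| : x ∈ Ω, |x - x0| ≤ r}`. -/
noncomputable def modCont (n : ℕ) {V : Type*} [NormedAddCommGroup V]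
    (Ω : Set (EuclideanSpace ℝ (Fin n))) (A : EuclideanSpace ℝ (Fin n) → V) (r : ℝ)
    (x0 : EuclideanSpace ℝ (Fin n)) : ℝ :=
  sSup {d : ℝ | ∃ x ∈ Ω, dist x x0 ≤ r ∧ d = ‖A x - A x0‖}

section Oscillation

variable {X V : Type*} [MeasurableSpace X] [NormedAddCommGroup V] [NormedSpace ℝ V]

/-- Up to a factor `2`, the mean oscillation is the mean distance to the best constant. -/
theorem integral_norm_sub_integral_le [CompleteSpace V] (ν : Measure X) [IsProbabilityMeasure ν]
    {f : X → V} (hf : Integrable f ν) (c : V) :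
    ∫ y, ‖f y - ∫ z, f z ∂ν‖ ∂ν ≤ 2 * ∫ y, ‖f y - c‖ ∂ν := by
  have hfc : Integrable (fun y => ‖f y - c‖) ν := (hf.sub (integrable_const c)).norm
  have hmean : ‖c - ∫ z, f z ∂ν‖ ≤ ∫ y, ‖f y - c‖ ∂ν := by
    have h : ∫ y, (f y - c) ∂ν = (∫ z, f z ∂ν) - c := by
      rw [integral_sub hf (integrable_const c)]
      simp
    rw [norm_sub_rev, ← h]
    exact norm_integral_le_integral_norm _
  calc ∫ y, ‖f y - ∫ z, f z ∂ν‖ ∂ν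
      ≤ ∫ y, (‖f y - c‖ + ‖c - ∫ z, f z ∂ν‖) ∂ν := by
        refine integral_mono (hf.sub (integrable_const _)).norm
          (hfc.add (integrable_const _)) fun y => ?_
        exact norm_sub_le_norm_sub_add_norm_sub _ _ _
    _ = (∫ y, ‖f y - c‖ ∂ν) + ‖c - ∫ z, f z ∂ν‖ := by
        rw [integral_add hfc (integrable_const _)]
        simp
    _ ≤ 2 * ∫ y, ‖f y - c‖ ∂ν := by linarith

/-- Mean oscillation of the product of a bounded scalar function of small oscillation and a
bounded vector-valued function. -/
theorem integral_norm_smul_sub_integral_le [CompleteSpace V] (ν : Measure X)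
    [IsProbabilityMeasure ν] {φ : X → ℝ} {A : X → V} {a : V} {p M K ρ : ℝ}
    (hφ : AEStronglyMeasurable φ ν) (hA : AEStronglyMeasurable A ν) (hK : 0 ≤ K)
    (hM : ∀ᵐ y ∂ν, |φ y| ≤ M) (hp : ∀ᵐ y ∂ν, |φ y - p| ≤ K) (hρ : ∀ᵐ y ∂ν, ‖A y - a‖ ≤ ρ) :
    ∫ y, ‖-(φ y • (A y - a)) - ∫ z, -(φ z • (A z - a)) ∂ν‖ ∂ν
      ≤ 2 * (M * (∫ y, ‖A y - ∫ z, A z ∂ν‖ ∂ν) + K * ρ) := by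
  have hBi : Integrable (fun y => A y - a) ν :=
    Integrable.of_bound (hA.sub aestronglyMeasurable_const) ρ hρ
  have hAi : Integrable A ν :=
    (hBi.add (integrable_const a)).congr (ae_of_all _ fun y => by simp)
  have hfi : Integrable (fun y => -(φ y • (A y - a))) ν :=
    (hBi.bdd_smul M hφ hM).neg
  have hmean : ∫ z, (A z - a) ∂ν = (∫ z, A z ∂ν) - a := by
    rw [integral_sub hAi (integrable_const a)]
    simp
  have hb : ‖(∫ z, A z ∂ν) - a‖ ≤ ρ := by
    rw [← hmean]
    simpa using norm_integral_le_of_norm_le_const hρ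
  have hosc : Integrable (fun y => ‖A y - ∫ z, A z ∂ν‖) ν :=
    (hAi.sub (integrable_const _)).norm
  refine (integral_norm_sub_integral_le ν hfi (-(p • ((∫ z, A z ∂ν) - a)))).trans ?_
  refine mul_le_mul_of_nonneg_left ?_ zero_le_two
  calc ∫ y, ‖-(φ y • (A y - a)) - -(p • ((∫ z, A z ∂ν) - a))‖ ∂ν
      ≤ ∫ y, (M * ‖A y - ∫ z, A z ∂ν‖ + K * ρ) ∂ν := by
        refine integral_mono_ae (hfi.sub (integrable_const _)).norm
          ((hosc.const_mul M).add (integrable_const _)) ?_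
        filter_upwards [hM, hp] with y hMy hpy
        have h : -(φ y • (A y - a)) - -(p • ((∫ z, A z ∂ν) - a))
            = -(φ y • (A y - ∫ z, A z ∂ν) + (φ y - p) • ((∫ z, A z ∂ν) - a)) := by
          module
        rw [h, norm_neg]
        refine (norm_add_le _ _).trans ?_
        rw [norm_smul, norm_smul, Real.norm_eq_abs, Real.norm_eq_abs]
        gcongr
    _ = M * (∫ y, ‖A y - ∫ z, A z ∂ν‖ ∂ν) + K * ρ := by
        rw [integral_add (hosc.const_mul M) (integrable_const _), integral_const_mul]
        simp

end Oscillation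

section MeanOsc

variable {n : ℕ} {V : Type*} [NormedAddCommGroup V] [NormedSpace ℝ V]
  {Ω : Set (EuclideanSpace ℝ (Fin n))}

theorem isProbabilityMeasure_average_inter_ball (hΩ : IsOpen Ω) {x : EuclideanSpace ℝ (Fin n)}
    (hx : x ∈ Ω) {t : ℝ} (ht : 0 < t) :
    IsProbabilityMeasure ((volume.restrict (Ω ∩ ball x t) univ)⁻¹ •
      volume.restrict (Ω ∩ ball x t)) := by
  have hpos : volume (Ω ∩ ball x t) ≠ 0 :=
    ((hΩ.inter isOpen_ball).measure_pos _ ⟨x, hx, mem_ball_self ht⟩).ne'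
  have hfin : volume (Ω ∩ ball x t) ≠ ⊤ :=
    ((measure_mono inter_subset_right).trans_lt measure_ball_lt_top).ne
  constructor
  simp [ENNReal.inv_mul_cancel hpos hfin]

theorem ae_average_inter_ball (hΩ : IsOpen Ω) {x : EuclideanSpace ℝ (Fin n)} {t : ℝ}
    {p : EuclideanSpace ℝ (Fin n) → Prop} (hp : ∀ y ∈ Ω ∩ ball x t, p y) :
    ∀ᵐ y ∂((volume.restrict (Ω ∩ ball x t) univ)⁻¹ • volume.restrict (Ω ∩ ball x t)), p y :=
  Measure.ae_smul_measure
    ((ae_restrict_iff' (hΩ.inter isOpen_ball).measurableSet).2 (ae_of_all _ hp)) _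

theorem meanOsc_nonneg (f : EuclideanSpace ℝ (Fin n) → V) (t : ℝ)
    (x : EuclideanSpace ℝ (Fin n)) : 0 ≤ meanOsc n Ω f t x :=
  integral_nonneg fun _ => norm_nonneg _

theorem meanOsc_le_of_norm_sub_le [CompleteSpace V] (hΩ : IsOpen Ω)
    {f : EuclideanSpace ℝ (Fin n) → V} (hf : StronglyMeasurable f) {a : V} {R : ℝ}
    (hR : ∀ y ∈ Ω, ‖f y - a‖ ≤ R) {x : EuclideanSpace ℝ (Fin n)} (hx : x ∈ Ω) {t : ℝ}
    (ht : 0 < t) : meanOsc n Ω f t x ≤ 2 * R := by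
  have := isProbabilityMeasure_average_inter_ball hΩ hx ht
  unfold meanOsc average
  set ν := (volume.restrict (Ω ∩ ball x t) univ)⁻¹ • volume.restrict (Ω ∩ ball x t)
  have hb : ∀ᵐ y ∂ν, ‖f y - a‖ ≤ R := ae_average_inter_ball hΩ fun y hy => hR y hy.1
  have hfa : Integrable (fun y => f y - a) ν :=
    Integrable.of_bound (hf.aestronglyMeasurable.sub aestronglyMeasurable_const) R hb
  have hfi : Integrable f ν :=
    (hfa.add (integrable_const a)).congr (ae_of_all _ fun y => by simp)
  refine (integral_norm_sub_integral_le ν hfi a).trans ?_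
  refine mul_le_mul_of_nonneg_left ?_ zero_le_two
  simpa using integral_mono_ae hfa.norm (integrable_const R) hb

theorem meanOsc_le_meanOscSup [CompleteSpace V] (hΩ : IsOpen Ω)
    {f : EuclideanSpace ℝ (Fin n) → V} (hf : StronglyMeasurable f) {a : V} {R : ℝ}
    (hR : ∀ y ∈ Ω, ‖f y - a‖ ≤ R) {x : EuclideanSpace ℝ (Fin n)} (hx : x ∈ Ω) {t : ℝ}
    (ht : 0 < t) : meanOsc n Ω f t x ≤ meanOscSup n Ω f t Ω := by
  refine le_csSup ⟨2 * R, ?_⟩ (mem_image_of_mem _ hx)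
  rintro _ ⟨z, hz, rfl⟩
  exact meanOsc_le_of_norm_sub_le hΩ hf hR hz ht

end MeanOsc

theorem norm_sub_le_modCont {n : ℕ} {V : Type*} [NormedAddCommGroup V]
    {Ω : Set (EuclideanSpace ℝ (Fin n))} {A : EuclideanSpace ℝ (Fin n) → V}
    {x0 : EuclideanSpace ℝ (Fin n)}
    {R : ℝ} (hR : ∀ x ∈ Ω, ‖A x - A x0‖ ≤ R) {s : ℝ} {x : EuclideanSpace ℝ (Fin n)}
    (hx : x ∈ Ω) (hs : dist x x0 ≤ s) : ‖A x - A x0‖ ≤ modCont n Ω A s x0 := by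
  refine le_csSup ⟨R, ?_⟩ ⟨x, hx, hs, rfl⟩
  rintro _ ⟨z, hz, -, rfl⟩
  exact hR z hz

/-- conditional form of the oscillation estimate in the proof of Theorem 1.2,
pole at `y0`: with `r = |x0 - y0|/5`, `η` Lipschitz with constant `4/δ`, `0 ≤ η ≤ 1`, and `G̃`
satisfying `|G̃(x)| ≤ C0 |x - y0|^{2-n}` on `Ω \ {y0}` and the oscillation bound (ii) over
`Ω(x0, 2r)`, the function `g̃ = -η (A - A(x0)) G̃` satisfies, for `0 < t ≤ r`,
`ω_g̃(t, Ω(x0,2r)) ≤ C r^{2-n} (ω_A(t) + ((r+δ)/(δr)) ϱ_A(3r,x0) t)` with `C = C(n,Λ0,C0)`.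
Matrices `ℝ^{n×n}` are modelled as `EuclideanSpace ℝ (Fin n × Fin n)`. -/
theorem meanOsc_cutoff_green_bound_pole_y0
    (n : ℕ) (hn : 3 ≤ n) (Λ0 C0 : ℝ) (hΛ0 : 0 ≤ Λ0) (hC0 : 0 ≤ C0) :
    ∃ C : ℝ, 0 < C ∧
    ∀ (Ω : Set (EuclideanSpace ℝ (Fin n))), Bornology.IsBounded Ω → IsOpen Ω →
    ∀ (A : EuclideanSpace ℝ (Fin n) → EuclideanSpace ℝ (Fin n × Fin n)), Measurable A →
    ∀ x0 ∈ Ω, (∀ x ∈ Ω, ‖A x - A x0‖ ≤ Λ0) →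
    ∀ y0 ∈ Ω, y0 ≠ x0 →
    ∀ r : ℝ, r = dist x0 y0 / 5 →
    ∀ δ : ℝ, 0 < δ →
    ∀ η : EuclideanSpace ℝ (Fin n) → ℝ, (∀ x, η x ∈ Icc (0:ℝ) 1) →
      LipschitzWith (Real.toNNReal (4 / δ)) η →
    ∀ G : EuclideanSpace ℝ (Fin n) → ℝ, Measurable G →
      (∀ x ∈ Ω \ {y0}, |G x| ≤ C0 * ‖x - y0‖ ^ ((2:ℝ) - n)) →
      (∀ t ∈ Ioc (0:ℝ) r, ∀ xb ∈ Ω ∩ ball x0 (2 * r),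
        ∀ x ∈ Ω ∩ ball xb t, ∀ y ∈ Ω ∩ ball xb t,
          |G x - G y| ≤ C0 * t * r ^ ((1:ℝ) - n)) →
    ∀ t ∈ Ioc (0:ℝ) r,
      meanOscSup n Ω (fun x => -((η x * G x) • (A x - A x0))) t (Ω ∩ ball x0 (2 * r))
        ≤ C * r ^ ((2:ℝ) - n) *
            (meanOscSup n Ω A t Ω
              + ((r + δ) / (δ * r)) * modCont n Ω A (3 * r) x0 * t) := by
  refine ⟨16 * C0 + 1, by positivity, ?_⟩
  intro Ω _ hΩ A hA x0 hx0 hAΛ y0 _ hne r hr δ hδ η hη hηL G hG hGb hGosc t ht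
  have hdist : dist x0 y0 = 5 * r := by rw [hr]; ring
  have hrpos : 0 < r := by
    have : 0 < dist x0 y0 := dist_pos.2 hne.symm
    linarith
  have hn' : (2 : ℝ) - n ≤ 0 := by
    have : (3 : ℝ) ≤ n := by exact_mod_cast hn
    linarith
  set P := r ^ ((2 : ℝ) - n)
  have hP : 0 ≤ P := Real.rpow_nonneg hrpos.le _
  have hP' : r ^ ((1 : ℝ) - n) = P / r := by
    rw [show (1 : ℝ) - n = (2 - n) - 1 by ring, Real.rpow_sub_one hrpos.ne']
  have hrδ : 0 ≤ (r + δ) / (δ * r) := by positivity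
  have hρ0 : 0 ≤ modCont n Ω A (3 * r) x0 :=
    (norm_nonneg _).trans (norm_sub_le_modCont hAΛ hx0 (by simpa using hrpos.le))
  have hAm : StronglyMeasurable A := hA.stronglyMeasurable
  refine csSup_le (Set.Nonempty.image _ ⟨x0, hx0, mem_ball_self (by linarith)⟩) ?_
  rintro _ ⟨xb, hxb, rfl⟩
  have ht0 : 0 < t := ht.1
  have hxbt : xb ∈ Ω ∩ ball xb t := ⟨hxb.1, mem_ball_self ht0⟩
  have hnear : ∀ y ∈ Ω ∩ ball xb t, dist y x0 ≤ 3 * r := fun y hy => by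
    have h1 := mem_ball.1 hy.2
    have h2 := mem_ball.1 hxb.2
    linarith [dist_triangle y xb x0, ht.2]
  have hGM : ∀ y ∈ Ω ∩ ball xb t, |G y| ≤ C0 * P := fun y hy => by
    have hfar : r ≤ ‖y - y0‖ := by
      rw [← dist_eq_norm]
      linarith [dist_triangle_left x0 y0 y, hnear y hy]
    have hy0 : y ≠ y0 := fun h => by simp [h] at hfar; linarith
    exact (hGb y ⟨hy.1, hy0⟩).trans
      (mul_le_mul_of_nonneg_left (Real.rpow_le_rpow_of_nonpos hrpos hfar hn') hC0)
  have hM : ∀ y ∈ Ω ∩ ball xb t, |η y * G y| ≤ C0 * P := fun y hy => by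
    rw [abs_mul, abs_of_nonneg (hη y).1]
    exact (mul_le_of_le_one_left (abs_nonneg _) (hη y).2).trans (hGM y hy)
  have hK : ∀ y ∈ Ω ∩ ball xb t,
      |η y * G y - η xb * G xb| ≤ 8 * C0 * P * ((r + δ) / (δ * r)) * t := fun y hy => by
    have hηd : |η y - η xb| ≤ 4 / δ * t := by
      have h := hηL.dist_le_mul y xb
      rw [Real.dist_eq, Real.coe_toNNReal _ (by positivity)] at h
      exact h.trans (by gcongr; exact (mem_ball.1 hy.2).le)
    have hGd := hGosc t ht xb hxb y hy xb hxbt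
    rw [hP'] at hGd
    calc |η y * G y - η xb * G xb|
        = |(η y - η xb) * G y + η xb * (G y - G xb)| := by ring_nf
      _ ≤ |η y - η xb| * |G y| + |η xb| * |G y - G xb| := by
          rw [← abs_mul, ← abs_mul]
          exact abs_add_le _ _
      _ ≤ 4 / δ * t * (C0 * P) + 1 * (C0 * t * (P / r)) := by
          gcongr
          · exact hGM y hy
          · rw [abs_of_nonneg (hη xb).1]
            exact (hη xb).2
      _ = C0 * P * t * (4 / δ + 1 / r) := by ring
      _ ≤ C0 * P * t * (8 / δ + 8 / r) := by gcongr <;> norm_num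
      _ = 8 * C0 * P * ((r + δ) / (δ * r)) * t := by field_simp
  have hprob := isProbabilityMeasure_average_inter_ball hΩ hxb.1 ht0
  have hmain : meanOsc n Ω (fun x => -((η x * G x) • (A x - A x0))) t xb
      ≤ 2 * (C0 * P * meanOsc n Ω A t xb
        + 8 * C0 * P * ((r + δ) / (δ * r)) * t * modCont n Ω A (3 * r) x0) :=
    integral_norm_smul_sub_integral_le _
      (hηL.continuous.measurable.mul hG).aestronglyMeasurable hAm.aestronglyMeasurable
      (by positivity) (ae_average_inter_ball hΩ hM) (ae_average_inter_ball hΩ hK)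
      (ae_average_inter_ball hΩ fun y hy => norm_sub_le_modCont hAΛ hy.1 (hnear y hy))
  have hω := meanOsc_le_meanOscSup hΩ hAm hAΛ hxb.1 ht0
  have hω0 : 0 ≤ meanOscSup n Ω A t Ω := (meanOsc_nonneg A t xb).trans hω
  calc meanOsc n Ω (fun x => -((η x * G x) • (A x - A x0))) t xb
      ≤ 2 * (C0 * P * meanOscSup n Ω A t Ω
        + 8 * C0 * P * ((r + δ) / (δ * r)) * t * modCont n Ω A (3 * r) x0) :=
        hmain.trans (by gcongr)
    _ = 2 * C0 * P * meanOscSup n Ω A t Ω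
        + 16 * C0 * P * ((r + δ) / (δ * r) * modCont n Ω A (3 * r) x0 * t) := by ring
    _ ≤ (16 * C0 + 1) * P * meanOscSup n Ω A t Ω
        + (16 * C0 + 1) * P * ((r + δ) / (δ * r) * modCont n Ω A (3 * r) x0 * t) := by
        gcongr <;> linarith
    _ = _ := by ring
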